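/- Let p be an odd prime, M = ℚ_p(ζ_p) the p-th cyclotomic extension of ℚ_p, and π = ζ_p − 1 (a uniformizer of M). Then (1 + π^p O_M) ∩ (M^×)^p = 1 + π^{p+1} O_M. -/

import Mathlib

section Ultrametric

variable {K : Type*} [NormedField K] [IsUltrametricDist K] {p : ℕ}

theorem exists_one_add_pow_prime_eq (hp : p.Prime) {a : K} (ha : ‖a‖ ≤ 1) :
    ∃ s : K, ‖s‖ ≤ 1 ∧ (1 + a) ^ p = 1 + p * a + p * a ^ 2 * s + a ^ p := by
  refine ⟨∑ k ∈ Finset.Ioo 1 p, a ^ (k - 2) * ((p.choose k / p : ℕ) : K), ?_, ?_⟩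
  · refine IsUltrametricDist.norm_sum_le_of_forall_le_of_nonneg zero_le_one fun k _ => ?_
    rw [norm_mul, norm_pow]
    exact mul_le_one₀ (pow_le_one₀ (norm_nonneg _) ha) (norm_nonneg _)
      (IsUltrametricDist.norm_natCast_le_one K _)
  · have hI : Finset.Ioo 0 p = insert 1 (Finset.Ioo 1 p) := by
      ext k
      have := hp.one_lt
      simp only [Finset.mem_Ioo, Finset.mem_insert]
      omega
    rw [add_comm, add_pow_prime_eq' hp, hI, Finset.sum_insert (by simp)]
    have hs : ∑ k ∈ Finset.Ioo 1 p, a ^ k * 1 ^ (p - k) * ((p.choose k / p : ℕ) : K) =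
        a ^ 2 * ∑ k ∈ Finset.Ioo 1 p, a ^ (k - 2) * ((p.choose k / p : ℕ) : K) := by
      rw [Finset.mul_sum]
      refine Finset.sum_congr rfl fun k hk => ?_
      have h2 : k = 2 + (k - 2) := by
        have := (Finset.mem_Ioo.1 hk).1
        omega
      rw [one_pow, mul_one, ← mul_assoc, ← pow_add, ← h2]
    rw [hs, Nat.choose_one_right, Nat.div_self hp.pos]
    simp only [pow_one, one_pow, Nat.cast_one]
    ring

theorem norm_sub_le_max_of_isUltrametricDist (x y : K) : ‖x - y‖ ≤ max ‖x‖ ‖y‖ := by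
  simpa [sub_eq_add_neg] using IsUltrametricDist.norm_add_le_max x (-y)

theorem exists_one_add_pow_eq {a : K} (ha : ‖a‖ ≤ 1) (n : ℕ) :
    ∃ c : K, ‖c‖ ≤ ‖a‖ ∧ (1 + a) ^ n = 1 + a * (n + c) := by
  induction n with
  | zero => exact ⟨0, by simp, by simp⟩
  | succ n ih =>
    obtain ⟨c, hc, h⟩ := ih
    refine ⟨c + a * (n + c), ?_, ?_⟩
    · refine (IsUltrametricDist.norm_add_le_max _ _).trans (max_le hc ?_)
      rw [norm_mul]
      refine mul_le_of_le_one_right (norm_nonneg _)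
        ((IsUltrametricDist.norm_add_le_max _ _).trans (max_le ?_ (hc.trans ha)))
      exact IsUltrametricDist.norm_natCast_le_one K n
    · rw [pow_succ, h]
      push_cast
      ring

theorem norm_one_add_eq_one {a : K} (ha : ‖a‖ < 1) : ‖1 + a‖ = 1 := by
  rw [IsUltrametricDist.norm_add_eq_max_of_norm_ne_norm (by simpa using ha.ne'), norm_one,
    max_eq_left ha.le]

theorem norm_sub_one_pow_of_pow_prime_eq_one (hp : p.Prime) (hp1 : ‖(p : K)‖ < 1) {ζ : K}
    (hζ : ζ ^ p = 1) (hζ1 : ζ ≠ 1) : ‖ζ - 1‖ < 1 ∧ ‖ζ - 1‖ ^ (p - 1) = ‖(p : K)‖ := by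
  have hn : ‖ζ‖ = 1 := by
    refine (pow_eq_one_iff_of_nonneg (norm_nonneg _) hp.ne_zero).1 ?_
    rw [← norm_pow, hζ, norm_one]
  have hle : ‖ζ - 1‖ ≤ 1 := by
    simpa [hn] using norm_sub_le_max_of_isUltrametricDist ζ 1
  obtain ⟨s, hs, h⟩ := exists_one_add_pow_prime_eq hp hle
  set π := ζ - 1 with hπ
  have hπ0 : π ≠ 0 := sub_ne_zero.2 hζ1
  have hpow : π ^ (p - 1) = -(p * (1 + π * s)) := by
    apply mul_right_cancel₀ hπ0
    rw [pow_sub_one_mul hp.ne_zero]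
    rw [hπ, add_sub_cancel, hζ, ← hπ] at h
    linear_combination -h
  have hπs : ‖π * s‖ ≤ ‖π‖ := by
    rw [norm_mul]
    exact mul_le_of_le_one_right (norm_nonneg _) hs
  have hnorm : ‖π‖ ^ (p - 1) = ‖(p : K)‖ * ‖1 + π * s‖ := by
    rw [← norm_pow, hpow, norm_neg, norm_mul]
  have h1 : ‖1 + π * s‖ ≤ 1 := by
    refine (IsUltrametricDist.norm_add_le_max _ _).trans ?_
    simpa using hπs.trans hle
  have hlt : ‖π‖ < 1 := by
    refine lt_of_not_ge fun hge => ?_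
    have : 1 ≤ ‖π‖ ^ (p - 1) := one_le_pow₀ hge
    nlinarith [norm_nonneg (p : K)]
  exact ⟨hlt, by rw [hnorm, norm_one_add_eq_one (hπs.trans_lt hlt), mul_one]⟩

variable {r : ℝ}

theorem norm_one_add_pow_prime_sub_le (hp : p.Prime) (hr0 : 0 ≤ r) (hr1 : r ≤ 1)
    (hr : r ^ (p - 1) = ‖(p : K)‖) {a : K} {k : ℕ} (ha : ‖a‖ ≤ r ^ (k + 2)) :
    ‖(1 + a) ^ p - 1 - p * a‖ ≤ r ^ (p + k + 2) := by
  obtain ⟨s, hs, h⟩ := exists_one_add_pow_prime_eq hp (ha.trans (pow_le_one₀ hr0 hr1))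
  have hp2 := hp.two_le
  have heq : (1 + a) ^ p - 1 - p * a = p * a ^ 2 * s + a ^ p := by linear_combination h
  rw [heq]
  refine (IsUltrametricDist.norm_add_le_max _ _).trans (max_le ?_ ?_)
  · calc ‖(p : K) * a ^ 2 * s‖ = r ^ (p - 1) * ‖a‖ ^ 2 * ‖s‖ := by
          rw [norm_mul, norm_mul, norm_pow, hr]
      _ ≤ r ^ (p - 1) * (r ^ (k + 2)) ^ 2 * 1 := by gcongr
      _ = r ^ (p - 1 + (k + 2) * 2) := by rw [mul_one, ← pow_mul, ← pow_add]
      _ ≤ r ^ (p + k + 2) := pow_le_pow_of_le_one hr0 hr1 (by omega)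
  · calc ‖a ^ p‖ ≤ (r ^ (k + 2)) ^ p := by rw [norm_pow]; gcongr
      _ = r ^ ((k + 2) * p) := (pow_mul _ _ _).symm
      _ ≤ r ^ (p + k + 2) := pow_le_pow_of_le_one hr0 hr1 (by nlinarith)

theorem norm_sub_one_le_of_norm_pow_prime_sub_one_le (hp : p.Prime) (hr0 : 0 < r) (hr1 : r < 1)
    (hr : r ^ (p - 1) = ‖(p : K)‖) {z : K} (hz : ‖z ^ p - 1‖ ≤ r ^ p) : ‖z - 1‖ ≤ r := by
  have hn : ‖z‖ = 1 := by
    refine (pow_eq_one_iff_of_nonneg (norm_nonneg _) hp.ne_zero).1 ?_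
    rw [← norm_pow, ← norm_one_add_eq_one (hz.trans_lt (pow_lt_one₀ hr0.le hr1 hp.ne_zero)),
      add_sub_cancel]
  have hle : ‖z - 1‖ ≤ 1 := by
    simpa [hn] using norm_sub_le_max_of_isUltrametricDist z 1
  obtain ⟨s, hs, h⟩ := exists_one_add_pow_prime_eq hp hle
  rw [add_sub_cancel] at h
  set a := z - 1
  have hs1 : ‖1 + a * s‖ ≤ 1 := by
    refine (IsUltrametricDist.norm_add_le_max _ _).trans ?_
    simpa using mul_le_one₀ hle (norm_nonneg _) hs
  have heq : a ^ p = (z ^ p - 1) - p * a * (1 + a * s) := by linear_combination -h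
  have hmax : ‖a‖ ^ p ≤ max (r ^ p) (r ^ (p - 1) * ‖a‖) := by
    rw [← norm_pow, heq]
    refine (norm_sub_le_max_of_isUltrametricDist _ _).trans (max_le_max hz ?_)
    rw [norm_mul, norm_mul, hr]
    exact mul_le_of_le_one_right (by positivity) hs1
  refine le_of_not_gt fun hlt => ?_
  rcases le_max_iff.1 hmax with h' | h'
  · exact absurd h' (pow_lt_pow_left₀ hlt hr0.le hp.ne_zero).not_ge
  · rw [← pow_sub_one_mul hp.ne_zero] at h'
    exact absurd (le_of_mul_le_mul_right h' (hr0.trans hlt))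
      (pow_lt_pow_left₀ hlt hr0.le (Nat.sub_ne_zero_of_lt hp.one_lt)).not_ge

theorem exists_norm_sub_pow_prime_le (hp : p.Prime) (hr0 : 0 < r) (hr1 : r < 1)
    (hr : r ^ (p - 1) = ‖(p : K)‖) {x : K} (hx : ‖x - 1‖ ≤ r ^ (p + 1)) (k : ℕ) :
    ∃ z : K, ‖z‖ = 1 ∧ ‖x - z ^ p‖ ≤ r ^ (p + k + 1) := by
  induction k with
  | zero => exact ⟨1, norm_one, by simpa using hx⟩
  | succ k ih =>
    obtain ⟨z, hz, h⟩ := ih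
    have hz0 : z ^ p ≠ 0 := pow_ne_zero _ (norm_pos_iff.1 (hz ▸ one_pos))
    have hp0 : (p : K) ≠ 0 := norm_pos_iff.1 (hr ▸ pow_pos hr0 _)
    set a := (x - z ^ p) / z ^ p / p with ha
    have hap : z ^ p * (p * a) = x - z ^ p := by
      rw [ha]
      field_simp
    have han : ‖a‖ ≤ r ^ (k + 2) := by
      have : ‖a‖ = ‖x - z ^ p‖ / r ^ (p - 1) := by
        rw [ha, norm_div, norm_div, norm_pow, hz, one_pow, div_one, hr]
      have hp1 := hp.one_lt
      rwa [this, div_le_iff₀ (pow_pos hr0 _), ← pow_add,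
        show k + 2 + (p - 1) = p + k + 1 by omega]
    refine ⟨z * (1 + a), ?_, ?_⟩
    · rw [norm_mul, hz, one_mul,
        norm_one_add_eq_one (han.trans_lt (pow_lt_one₀ hr0.le hr1 (by omega)))]
    · have heq : x - (z * (1 + a)) ^ p = -(z ^ p * ((1 + a) ^ p - 1 - p * a)) := by
        rw [mul_pow]
        linear_combination -hap
      rw [heq, norm_neg, norm_mul, norm_pow, hz, one_pow, one_mul]
      exact norm_one_add_pow_prime_sub_le hp hr0.le hr1.le hr han

theorem exists_pow_prime_eq_of_norm_sub_one_le [ProperSpace K] (hp : p.Prime) (hr0 : 0 < r)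
    (hr1 : r < 1) (hr : r ^ (p - 1) = ‖(p : K)‖) {x : K} (hx : ‖x - 1‖ ≤ r ^ (p + 1)) :
    ∃ z : K, z ^ p = x := by
  have hc : IsClosed ((fun z : K => z ^ p) '' Metric.sphere 0 1) :=
    ((isCompact_sphere 0 1).image (continuous_pow p)).isClosed
  suffices x ∈ closure ((fun z : K => z ^ p) '' Metric.sphere 0 1) by
    obtain ⟨z, -, hz⟩ := hc.closure_eq ▸ this
    exact ⟨z, hz⟩
  refine Metric.mem_closure_iff.2 fun ε hε => ?_
  obtain ⟨k, hk⟩ := exists_pow_lt_of_lt_one hε hr1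
  obtain ⟨z, hz, h⟩ := exists_norm_sub_pow_prime_le hp hr0 hr1 hr hx k
  refine ⟨z ^ p, ⟨z, by simpa using hz, rfl⟩, ?_⟩
  rw [dist_eq_norm]
  exact h.trans_lt ((pow_le_pow_of_le_one hr0.le hr1.le (by omega)).trans_lt hk)

end Ultrametric

section Padic

variable {p : ℕ} [hp : Fact p.Prime]

theorem Padic.exists_natCast_norm_sub_le {c : ℚ_[p]} (hc : ‖c‖ ≤ 1) :
    ∃ n : ℕ, ‖c - n‖ ≤ ‖(p : ℚ_[p])‖ := by
  obtain ⟨c, rfl⟩ : ∃ c' : ℤ_[p], (c' : ℚ_[p]) = c := ⟨⟨c, hc⟩, rfl⟩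
  obtain ⟨n, -, hn⟩ := PadicInt.exists_mem_range c
  refine ⟨n, ?_⟩
  rw [PadicInt.maximalIdeal_eq_span_p, ← pow_one (p : ℤ_[p]),
    ← PadicInt.norm_le_pow_iff_mem_span_pow] at hn
  rw [PadicInt.norm_def, PadicInt.coe_sub, PadicInt.coe_natCast, Nat.cast_one, zpow_neg_one] at hn
  rwa [Padic.norm_p]

theorem isUltrametricDist_of_norm_algebraMap_padic {M : Type*} [NormedField M]
    [Algebra ℚ_[p] M] (hnorm : ∀ y : ℚ_[p], ‖algebraMap ℚ_[p] M y‖ = ‖y‖) :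
    IsUltrametricDist M := by
  refine IsUltrametricDist.isUltrametricDist_of_forall_norm_natCast_le_one fun n => ?_
  rw [← map_natCast (algebraMap ℚ_[p] M), hnorm]
  exact IsUltrametricDist.norm_natCast_le_one _ n

theorem properSpace_of_norm_algebraMap_padic {M : Type*} [NormedField M] [Algebra ℚ_[p] M]
    [FiniteDimensional ℚ_[p] M] (hnorm : ∀ y : ℚ_[p], ‖algebraMap ℚ_[p] M y‖ = ‖y‖) :
    ProperSpace M := by
  let _ : NormedSpace ℚ_[p] M :=
    { norm_smul_le := fun c x => by rw [Algebra.smul_def, norm_mul, hnorm] }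
  exact FiniteDimensional.proper ℚ_[p] M

/-- Elements of the valuation ring of a totally ramified extension of `ℚ_p` generated by a
uniformizer `π` are congruent to natural numbers modulo `π`. -/
theorem exists_natCast_norm_sub_aeval_le {M : Type*} [NormedField M] [Algebra ℚ_[p] M]
    [IsUltrametricDist M] (hnorm : ∀ y : ℚ_[p], ‖algebraMap ℚ_[p] M y‖ = ‖y‖) {π : M}
    {d : ℕ} (hπ0 : 0 < ‖π‖) (hπ1 : ‖π‖ < 1) (hd : d ≠ 0) (hπ : ‖π‖ ^ d = ‖(p : ℚ_[p])‖)
    {f : Polynomial ℚ_[p]} (hf : f.degree < d) (h : ‖Polynomial.aeval π f‖ ≤ 1) :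
    ∃ n : ℕ, ‖Polynomial.aeval π f - n‖ ≤ ‖π‖ := by
  have hsum : Polynomial.aeval π f =
      ∑ i ∈ f.support, algebraMap ℚ_[p] M (f.coeff i) * π ^ i := by
    rw [Polynomial.aeval_def, Polynomial.eval₂_eq_sum, Polynomial.sum_def]
  have hlt : ∀ i ∈ f.support, i < d := fun i hi => by
    exact_mod_cast (Polynomial.le_degree_of_mem_supp i hi).trans_lt hf
  have hterm : ∀ i ∈ f.support, ‖algebraMap ℚ_[p] M (f.coeff i) * π ^ i‖ =
      ‖π‖ ^ (d * (f.coeff i).valuation + i : ℤ) := fun i hi => by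
    rw [norm_mul, hnorm, Padic.norm_eq_zpow_neg_valuation (Polynomial.mem_support_iff.1 hi),
      norm_pow, zpow_neg, ← inv_zpow, ← Padic.norm_p, ← hπ, zpow_add₀ hπ0.ne', zpow_mul,
      zpow_natCast, zpow_natCast]
  have hpair : Set.Pairwise (f.support : Set ℕ) fun i j =>
      ‖algebraMap ℚ_[p] M (f.coeff i) * π ^ i‖₊ ≠ ‖algebraMap ℚ_[p] M (f.coeff j) * π ^ j‖₊ := by
    intro i hi j hj hij heq
    have heq' := congrArg NNReal.toReal heq
    rw [coe_nnnorm, coe_nnnorm, hterm i hi, hterm j hj] at heq'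
    have := congrArg (· % (d : ℤ)) (zpow_right_injective₀ hπ0 hπ1.ne heq')
    simp only [Int.mul_add_emod_self_left] at this
    rw [Int.emod_eq_of_lt (by omega) (by exact_mod_cast hlt i hi),
      Int.emod_eq_of_lt (by omega) (by exact_mod_cast hlt j hj)] at this
    exact hij (by exact_mod_cast this)
  have hle : ∀ i ∈ f.support, ‖algebraMap ℚ_[p] M (f.coeff i) * π ^ i‖ ≤ 1 := fun i hi => by
    refine le_trans ?_ h
    rw [hsum, ← coe_nnnorm, ← coe_nnnorm,
      IsUltrametricDist.nnnorm_sum_eq_sup_of_pairwise_ne hpair]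
    exact_mod_cast Finset.le_sup (f := fun i => ‖algebraMap ℚ_[p] M (f.coeff i) * π ^ i‖₊) hi
  have hcoeff : ‖f.coeff 0‖ ≤ 1 := by
    by_cases h0 : f.coeff 0 = 0
    · simp [h0]
    · simpa [hnorm] using hle 0 (Polynomial.mem_support_iff.2 h0)
  obtain ⟨n, hn⟩ := Padic.exists_natCast_norm_sub_le hcoeff
  refine ⟨n, ?_⟩
  have hsplit : Polynomial.aeval π f - n = algebraMap ℚ_[p] M (f.coeff 0 - n) +
      ∑ i ∈ f.support.erase 0, algebraMap ℚ_[p] M (f.coeff i) * π ^ i := by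
    rw [hsum, map_sub, map_natCast]
    by_cases h0 : 0 ∈ f.support
    · rw [← Finset.add_sum_erase _ _ h0]
      ring
    · rw [Finset.erase_eq_of_notMem h0, Polynomial.notMem_support_iff.1 h0, map_zero]
      ring
  rw [hsplit]
  refine (IsUltrametricDist.norm_add_le_max _ _).trans (max_le ?_ ?_)
  · rw [hnorm]
    exact hn.trans (hπ ▸ pow_le_of_le_one hπ0.le hπ1.le hd)
  · refine IsUltrametricDist.norm_sum_le_of_forall_le_of_nonneg hπ0.le fun i hi => ?_
    obtain ⟨hi0, hi⟩ := Finset.mem_erase.1 hi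
    have h1 := hle i hi
    rw [hterm i hi] at h1 ⊢
    rw [zpow_le_one_iff_right_of_lt_one₀ hπ0 hπ1] at h1
    have hne : (d * (f.coeff i).valuation + i : ℤ) ≠ 0 := fun h0 => by
      have hdvd : (d : ℤ) ∣ i := ⟨-(f.coeff i).valuation, by linarith⟩
      exact hi0 (Nat.eq_zero_of_dvd_of_lt (by exact_mod_cast hdvd) (hlt i hi))
    calc ‖π‖ ^ (d * (f.coeff i).valuation + i : ℤ) ≤ ‖π‖ ^ (1 : ℤ) :=
          zpow_le_zpow_right_of_le_one₀ hπ0 hπ1.le (by omega)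
      _ = ‖π‖ := zpow_one _

/-- In `ℚ_p[ζ]`, with `ζ` a primitive `p`-th root of unity, every element is a polynomial of
degree less than `p - 1` in `ζ - 1`. -/
theorem exists_aeval_sub_one_eq {F M : Type*} [Field F] [Field M] [Algebra F M] {ζ : M}
    (hζ : IsPrimitiveRoot ζ p) (hgen : Algebra.adjoin F ({ζ} : Set M) = ⊤) (b : M) :
    ∃ f : Polynomial F, f.degree < (p - 1 : ℕ) ∧ Polynomial.aeval (ζ - 1) f = b := by
  have hb : b ∈ Algebra.adjoin F ({ζ} : Set M) := hgen ▸ Algebra.mem_top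
  rw [Algebra.adjoin_singleton_eq_range_aeval] at hb
  obtain ⟨g, rfl⟩ := hb
  set Φ := Polynomial.cyclotomic p F
  have hΦ : Φ.Monic := Polynomial.cyclotomic.monic p F
  have hroot : Polynomial.aeval ζ Φ = 0 := by
    rw [Polynomial.aeval_def, ← Polynomial.eval_map, Polynomial.map_cyclotomic]
    exact hζ.isRoot_cyclotomic hp.out.pos
  refine ⟨Polynomial.taylor 1 (g %ₘ Φ), ?_, ?_⟩
  · rw [Polynomial.degree_taylor]
    refine (Polynomial.degree_modByMonic_lt g hΦ).trans_eq ?_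
    rw [Polynomial.degree_cyclotomic, Nat.totient_prime hp.out]
  · rw [Polynomial.taylor_apply, Polynomial.aeval_comp]
    simp only [map_add, Polynomial.aeval_X, map_one, sub_add_cancel]
    exact Polynomial.aeval_modByMonic_eq_self_of_root hroot

end Padic

/-- Let `p` be an odd prime and `M = ℚ_p(ζ_p)` the `p`-th cyclotomic extension of `ℚ_p`
(formalized: `ζ` is a primitive `p`-th root of unity generating `M` over `ℚ_p`), equipped
with the unique absolute value extending the `p`-adic one, and let `π = ζ_p − 1`, a
uniformizer of `M`.  Then `(1 + π^p O_M) ∩ (M^×)^p = 1 + π^{p+1} O_M`, where membership of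
`x` in `1 + π^k O_M` is expressed as `‖x − 1‖ ≤ ‖π‖^k`. -/
theorem cyclotomic_pth_powers_inter (p : ℕ) [hp : Fact p.Prime] (hp2 : p ≠ 2) (M : Type*)
    [NormedField M] [Algebra ℚ_[p] M]
    (hnorm : ∀ y : ℚ_[p], ‖algebraMap ℚ_[p] M y‖ = ‖y‖)
    (ζ : M) (hζ : IsPrimitiveRoot ζ p)
    (hgen : Algebra.adjoin ℚ_[p] ({ζ} : Set M) = ⊤) :
    ∀ x : M,
      (‖x - 1‖ ≤ ‖ζ - 1‖ ^ p ∧ ∃ z : M, z ≠ 0 ∧ x = z ^ p) ↔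
        ‖x - 1‖ ≤ ‖ζ - 1‖ ^ (p + 1) := by
  have hpr := hp.out
  have := isUltrametricDist_of_norm_algebraMap_padic hnorm
  have : FiniteDimensional ℚ_[p] M := by
    have hint : IsIntegral ℚ_[p] ζ :=
      IsIntegral.of_pow hpr.pos (by rw [hζ.pow_eq_one]; exact isIntegral_one)
    exact Module.finite_def.2 (by simpa [hgen] using hint.fg_adjoin_singleton)
  have := properSpace_of_norm_algebraMap_padic hnorm
  have hpn : ‖(p : M)‖ = ‖(p : ℚ_[p])‖ := by rw [← hnorm, map_natCast]
  have hζ1 : ζ ≠ 1 := hζ.ne_one hpr.one_lt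
  obtain ⟨hr1, hr⟩ := norm_sub_one_pow_of_pow_prime_eq_one hpr
    (hpn ▸ Padic.norm_p_lt_one) hζ.pow_eq_one hζ1
  have hr0 : 0 < ‖ζ - 1‖ := norm_pos_iff.2 (sub_ne_zero.2 hζ1)
  have hπ0 : ζ - 1 ≠ 0 := sub_ne_zero.2 hζ1
  have hζn : ‖ζ‖ = 1 := by simpa using norm_one_add_eq_one hr1
  intro x
  constructor
  · rintro ⟨hx, z, -, rfl⟩
    have hz := norm_sub_one_le_of_norm_pow_prime_sub_one_le hpr hr0 hr1 hr hx
    obtain ⟨f, hf, hfb⟩ := exists_aeval_sub_one_eq hζ hgen ((z - 1) / (ζ - 1))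
    have hb : ‖(z - 1) / (ζ - 1)‖ ≤ 1 := by
      rw [norm_div]
      exact div_le_one_of_le₀ hz hr0.le
    obtain ⟨n, hn⟩ := exists_natCast_norm_sub_aeval_le hnorm hr0 hr1
      (Nat.sub_ne_zero_of_lt hpr.one_lt) (hr.trans hpn) hf (hfb ▸ hb)
    rw [hfb] at hn
    -- Dividing `z` by `ζ ^ n` does not change its `p`-th power and moves it closer to `1`.
    obtain ⟨c, hc, hcn⟩ : ∃ c : M, ‖c‖ ≤ ‖ζ - 1‖ ∧ ζ ^ n = 1 + (ζ - 1) * (n + c) := by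
      simpa only [add_sub_cancel] using exists_one_add_pow_eq hr1.le n
    have hζ0 : ζ ^ n ≠ 0 := pow_ne_zero _ (hζ.ne_zero hpr.ne_zero)
    set a := z / ζ ^ n - 1 with ha
    have haz : (1 + a) ^ p = z ^ p := by
      rw [ha, add_sub_cancel, div_pow, ← pow_mul, mul_comm n, pow_mul, hζ.pow_eq_one, one_pow,
        div_one]
    have han : ‖a‖ ≤ ‖ζ - 1‖ ^ (0 + 2) := by
      have heq : a = (ζ - 1) * ((z - 1) / (ζ - 1) - n - c) / ζ ^ n := by
        rw [ha, eq_div_iff hζ0, sub_mul, div_mul_cancel₀ _ hζ0, one_mul]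
        nth_rewrite 1 [hcn]
        rw [mul_sub, mul_sub, mul_div_cancel₀ _ hπ0]
        ring
      rw [heq, norm_div, norm_pow, hζn, one_pow, div_one, norm_mul, zero_add, pow_two]
      gcongr
      exact (norm_sub_le_max_of_isUltrametricDist _ _).trans (max_le hn hc)
    rw [← haz, ← sub_add_cancel ((1 + a) ^ p - 1) (p * a)]
    refine (IsUltrametricDist.norm_add_le_max _ _).trans (max_le ?_ ?_)
    · exact (norm_one_add_pow_prime_sub_le hpr hr0.le hr1.le hr han).trans
        (pow_le_pow_of_le_one hr0.le hr1.le (by omega))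
    · calc ‖(p : M) * a‖ = ‖ζ - 1‖ ^ (p - 1) * ‖a‖ := by rw [norm_mul, hr]
        _ ≤ ‖ζ - 1‖ ^ (p - 1) * ‖ζ - 1‖ ^ (0 + 2) := by gcongr
        _ = ‖ζ - 1‖ ^ (p + 1) := by
          rw [← pow_add]
          congr 1
          have := hpr.one_lt
          omega
  · intro hx
    refine ⟨hx.trans (pow_le_pow_of_le_one hr0.le hr1.le (by omega)), ?_⟩
    obtain ⟨z, rfl⟩ := exists_pow_prime_eq_of_norm_sub_one_le hpr hr0 hr1 hr hx
    refine ⟨z, ?_, rfl⟩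
    rintro rfl
    rw [zero_pow hpr.ne_zero, zero_sub, norm_neg, norm_one] at hx
    exact absurd hx (pow_lt_one₀ hr0.le hr1 (by omega)).not_ge
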